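/- The average linear stabilizer entropy of a Haar-random state of the intertwiner (SU(2)-gauge invariant) subspace of four qubits, computed with respect to the full 4-qubit Pauli basis, equals 17/45: ∫_{U(2)} M_lin^{(0)}( u₀₀|0_s⟩ + u₁₀|1_s⟩ ) dμ(U) = 17/45, where (u₀₀, u₁₀) is the first column of U ∈ U(2), so that u₀₀|0_s⟩ + u₁₀|1_s⟩ = ιUe₀ is the Haar-random unit vector of the intertwiner subspace obtained via the isometry ι : ℂ² → (ℂ²)^⊗4 sending e₀ ↦ |0_s⟩, e₁ ↦ |1_s⟩. -/

import Mathlib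

open Matrix MeasureTheory BigOperators

noncomputable section

/-- The four 2×2 Pauli matrices: σ₀ = I, σ₁ = X, σ₂ = Y, σ₃ = Z. -/
def pauli : Fin 4 → Matrix (Fin 2) (Fin 2) ℂ
  | 0 => 1
  | 1 => !![0, 1; 1, 0]
  | 2 => !![0, -Complex.I; Complex.I, 0]
  | 3 => !![1, 0; 0, -1]

/-- Pauli string `σ_{f(1)} ⊗ ⋯ ⊗ σ_{f(n)}` on `n` qubits, as a matrix on
`(ℂ²)^⊗n`, realized as functions `(Fin n → Fin 2) → ℂ`. -/
def pauliString {n : ℕ} (f : Fin n → Fin 4) :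
    Matrix (Fin n → Fin 2) (Fin n → Fin 2) ℂ :=
  Matrix.of fun r c => ∏ k, pauli (f k) (r k) (c k)

/-- Computational basis vector `|b₁…b_n⟩`. -/
def ket {n : ℕ} (b : Fin n → Fin 2) : (Fin n → Fin 2) → ℂ :=
  fun i => if i = b then 1 else 0

/-- Logical intertwiner basis vector
`|0_s⟩ = ½(|0101⟩+|1010⟩−|0110⟩−|1001⟩)`. -/
def zeroS : (Fin 4 → Fin 2) → ℂ :=
  (2 : ℂ)⁻¹ • (ket ![0,1,0,1] + ket ![1,0,1,0] - ket ![0,1,1,0] - ket ![1,0,0,1])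

/-- Logical intertwiner basis vector
`|1_s⟩ = (1/√3)[|0011⟩+|1100⟩ − ½(|0101⟩+|1010⟩+|0110⟩+|1001⟩)]`. -/
def oneS : (Fin 4 → Fin 2) → ℂ :=
  ((Real.sqrt 3 : ℂ))⁻¹ • (ket ![0,0,1,1] + ket ![1,1,0,0]
    - (2 : ℂ)⁻¹ • (ket ![0,1,0,1] + ket ![1,0,1,0] + ket ![0,1,1,0] + ket ![1,0,0,1]))

/-- Borel measurable structure on the unitary group. -/
instance (ι : Type*) [Fintype ι] [DecidableEq ι] :
    MeasurableSpace (Matrix.unitaryGroup ι ℂ) := borel _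

instance (ι : Type*) [Fintype ι] [DecidableEq ι] :
    BorelSpace (Matrix.unitaryGroup ι ℂ) := ⟨rfl⟩

/-- The linear stabilizer entropy of a 4-qubit state with respect to the full
4-qubit Pauli basis `𝒫₄` (`d₀ = 16`): `M_lin⁽⁰⁾(ψ) = 1 − d₀⁻¹ Σ_{P∈𝒫₄} ⟨ψ|P|ψ⟩⁴`.
Since `⟨ψ|P|ψ⟩` is real for Hermitian `P`, we take its real part. -/
def Mlin0 (ψ : (Fin 4 → Fin 2) → ℂ) : ℝ :=
  1 - (16 : ℝ)⁻¹ * ∑ f : Fin 4 → Fin 4, ((star ψ ⬝ᵥ (pauliString f).mulVec ψ).re) ^ 4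

/-- Entries of the Pauli matrices, as Gaussian integers. -/
def pauliEntry : Fin 4 → Fin 2 → Fin 2 → GaussianInt
  | 0 => ![![1, 0], ![0, 1]]
  | 1 => ![![0, 1], ![1, 0]]
  | 2 => ![![0, ⟨0, -1⟩], ![⟨0, 1⟩, 0]]
  | 3 => ![![1, 0], ![0, -1]]

lemma pauli_apply (a : Fin 4) (r c : Fin 2) : pauli a r c = (pauliEntry a r c : ℂ) := by
  fin_cases a <;> fin_cases r <;> fin_cases c <;>
    simp [pauli, pauliEntry, GaussianInt.toComplex_def]

/-- Entries of the 4-qubit Pauli strings, as Gaussian integers. -/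
def pauliStringEntry (f : Fin 4 → Fin 4) (r c : Fin 4 → Fin 2) : GaussianInt :=
  pauliEntry (f 0) (r 0) (c 0) * pauliEntry (f 1) (r 1) (c 1) *
    pauliEntry (f 2) (r 2) (c 2) * pauliEntry (f 3) (r 3) (c 3)

lemma pauliString_apply (f : Fin 4 → Fin 4) (r c : Fin 4 → Fin 2) :
    pauliString f r c = (pauliStringEntry f r c : ℂ) := by
  simp [pauliString, Fin.prod_univ_four, pauli_apply, pauliStringEntry]

/-- The weight-two bit strings, grouped into pairs of complementary strings. -/
def balancedString : Fin 3 → Fin 2 → Fin 4 → Fin 2 :=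
  ![![![0, 1, 0, 1], ![1, 0, 1, 0]], ![![0, 1, 1, 0], ![1, 0, 0, 1]],
    ![![0, 0, 1, 1], ![1, 1, 0, 0]]]

/-- The vector with amplitude `v j` on both strings of the `j`-th complementary pair. -/
def balancedState (v : Fin 3 → ℂ) : (Fin 4 → Fin 2) → ℂ :=
  ∑ j, v j • (ket (balancedString j 0) + ket (balancedString j 1))

/-- Matrix of a Pauli string compressed to the span of the `balancedState`s. -/
def compressedEntry (f : Fin 4 → Fin 4) (j k : Fin 3) : GaussianInt :=
  pauliStringEntry f (balancedString j 0) (balancedString k 0) +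
    pauliStringEntry f (balancedString j 0) (balancedString k 1) +
    pauliStringEntry f (balancedString j 1) (balancedString k 0) +
    pauliStringEntry f (balancedString j 1) (balancedString k 1)

lemma ket_dotProduct {n : ℕ} (b : Fin n → Fin 2) (w : (Fin n → Fin 2) → ℂ) :
    star (ket b) ⬝ᵥ w = w b := by
  simp [dotProduct, ket, apply_ite]

lemma mulVec_ket {n : ℕ} (M : Matrix (Fin n → Fin 2) (Fin n → Fin 2) ℂ) (b r : Fin n → Fin 2) :
    (M *ᵥ ket b) r = M r b := by
  simp [mulVec, dotProduct, ket]

lemma expectation_balancedState (f : Fin 4 → Fin 4) (v : Fin 3 → ℂ) :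
    star (balancedState v) ⬝ᵥ (pauliString f).mulVec (balancedState v) =
      ∑ j, ∑ k, star (v j) * v k * (compressedEntry f j k : ℂ) := by
  simp only [balancedState, star_sum, star_smul, star_add, sum_dotProduct, smul_dotProduct,
    add_dotProduct, ket_dotProduct, mulVec_sum, mulVec_smul, mulVec_add, Finset.sum_apply,
    Pi.smul_apply, Pi.add_apply, mulVec_ket, pauliString_apply, compressedEntry, smul_eq_mul,
    GaussianInt.toComplex_add, ← Finset.sum_add_distrib, Finset.mul_sum]
  refine Finset.sum_congr rfl fun j _ => Finset.sum_congr rfl fun k _ => ?_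
  ring

/-- Twice the coefficients of the expectation value of a Pauli string in a `balancedState v` with
`∑ j, v j = 0`, with respect to `|v 0|²`, `|v 1|²`, `|v 2|²` and `Im (star (v 0) * v 1)`. -/
def expectationCoeff (f : Fin 4 → Fin 4) : ℤ × ℤ × ℤ × ℤ :=
  let m := compressedEntry f
  let s := (m 0 1).re + (m 1 0).re
  let t := (m 1 2).re + (m 2 1).re
  let u := (m 2 0).re + (m 0 2).re
  (2 * (m 0 0).re - s - u + t, 2 * (m 1 1).re - s - t + u, 2 * (m 2 2).re - t - u + s,
    2 * ((m 1 0).im - (m 0 1).im + ((m 2 1).im - (m 1 2).im) + ((m 0 2).im - (m 2 0).im)))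

lemma expectation_re (f : Fin 4 → Fin 4) (v : Fin 3 → ℂ) (hv : v 0 + v 1 + v 2 = 0) :
    (star (balancedState v) ⬝ᵥ (pauliString f).mulVec (balancedState v)).re =
      ((expectationCoeff f).1 * Complex.normSq (v 0) +
        (expectationCoeff f).2.1 * Complex.normSq (v 1) +
        (expectationCoeff f).2.2.1 * Complex.normSq (v 2) +
        (expectationCoeff f).2.2.2 * (star (v 0) * v 1).im) / 2 := by
  have h2 : v 2 = -v 0 - v 1 := by linear_combination hv
  simp [expectation_balancedState, Fin.sum_univ_three, expectationCoeff, h2, Complex.normSq_apply]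
  ring

lemma map_expectationCoeff :
    (Finset.univ : Finset (Fin 4 → Fin 4)).val.map expectationCoeff =
      Multiset.replicate 192 (0, 0, 0, 0) + Multiset.replicate 4 (4, 4, 4, 0) +
      Multiset.replicate 12 (0, 0, 0, 8) + Multiset.replicate 12 (0, 0, 0, -8) +
      Multiset.replicate 6 (4, 4, -4, 0) + Multiset.replicate 6 (4, -4, 4, 0) +
      Multiset.replicate 6 (-4, 4, 4, 0) + Multiset.replicate 6 (4, -4, -4, 0) +
      Multiset.replicate 6 (-4, 4, -4, 0) + Multiset.replicate 6 (-4, -4, 4, 0) := by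
  decide +kernel

lemma sum_expectation_pow (v : Fin 3 → ℂ) (hv : v 0 + v 1 + v 2 = 0) (A B C Y : ℝ)
    (hA : Complex.normSq (v 0) = A) (hB : Complex.normSq (v 1) = B)
    (hC : Complex.normSq (v 2) = C) (hY : (star (v 0) * v 1).im = Y) :
    ∑ f : Fin 4 → Fin 4,
      ((star (balancedState v) ⬝ᵥ (pauliString f).mulVec (balancedState v)).re) ^ 4 =
    64 * (A + B + C) ^ 4 + 6144 * Y ^ 4 +
      192 * ((A + B - C) ^ 4 + (A - B + C) ^ 4 + (-A + B + C) ^ 4) := by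
  let h : ℤ × ℤ × ℤ × ℤ → ℝ := fun c => ((c.1 * A + c.2.1 * B + c.2.2.1 * C + c.2.2.2 * Y) / 2) ^ 4
  have key : ∑ f : Fin 4 → Fin 4, h (expectationCoeff f) =
      (((Finset.univ : Finset (Fin 4 → Fin 4)).val.map expectationCoeff).map h).sum := by
    rw [Multiset.map_map]; rfl
  simp only [expectation_re _ v hv, hA, hB, hC, hY]
  refine key.trans ?_
  rw [map_expectationCoeff]
  simp only [h, Multiset.map_add, Multiset.map_replicate, Multiset.sum_add,
    Multiset.sum_replicate, nsmul_eq_mul]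
  push_cast
  ring

lemma smul_zeroS_add_smul_oneS (a b : ℂ) :
    a • zeroS + b • oneS =
      balancedState ![a / 2 - b / (2 * (Real.sqrt 3 : ℂ)), -a / 2 - b / (2 * (Real.sqrt 3 : ℂ)),
        b / (Real.sqrt 3 : ℂ)] := by
  ext i
  simp only [zeroS, oneS, balancedState, balancedString, Fin.sum_univ_three, Pi.add_apply,
    Pi.sub_apply, Pi.smul_apply, smul_eq_mul, cons_val_zero, cons_val_one, cons_val]
  field_simp
  ring

/-- First Bloch coordinate of the first column of a unitary. -/
def blochX (U : Matrix.unitaryGroup (Fin 2) ℂ) : ℝ :=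
  2 * ((U.1 0 0).re * (U.1 1 0).re + (U.1 0 0).im * (U.1 1 0).im)

/-- Second Bloch coordinate of the first column of a unitary. -/
def blochY (U : Matrix.unitaryGroup (Fin 2) ℂ) : ℝ :=
  2 * ((U.1 0 0).re * (U.1 1 0).im - (U.1 0 0).im * (U.1 1 0).re)

/-- Third Bloch coordinate of the first column of a unitary. -/
def blochZ (U : Matrix.unitaryGroup (Fin 2) ℂ) : ℝ :=
  (U.1 0 0).re ^ 2 + (U.1 0 0).im ^ 2 - ((U.1 1 0).re ^ 2 + (U.1 1 0).im ^ 2)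

lemma normSq_first_column (U : Matrix.unitaryGroup (Fin 2) ℂ) :
    (U.1 0 0).re ^ 2 + (U.1 0 0).im ^ 2 + ((U.1 1 0).re ^ 2 + (U.1 1 0).im ^ 2) = 1 := by
  have h := congrArg Complex.re (congrFun (congrFun (Matrix.mem_unitaryGroup_iff'.1 U.2) 0) 0)
  simp [Matrix.mul_apply, Fin.sum_univ_two] at h
  linarith

lemma bloch_sq_add (U : Matrix.unitaryGroup (Fin 2) ℂ) :
    blochX U ^ 2 + blochY U ^ 2 + blochZ U ^ 2 = 1 := by
  have h := normSq_first_column U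
  simp only [blochX, blochY, blochZ]
  linear_combination ((U.1 0 0).re ^ 2 + (U.1 0 0).im ^ 2 +
    ((U.1 1 0).re ^ 2 + (U.1 1 0).im ^ 2) + 1) * h

lemma Mlin0_eq_bloch (U : Matrix.unitaryGroup (Fin 2) ℂ) :
    Mlin0 ((U.1 0 0) • zeroS + (U.1 1 0) • oneS) =
      1 - (5 + 3 * blochY U ^ 4 + 6 * (blochX U ^ 2 + blochZ U ^ 2) +
        3 * (blochX U ^ 2 + blochZ U ^ 2) ^ 2 +
        4 * (blochZ U ^ 3 - 3 * (blochZ U * blochX U ^ 2))) / 18 := by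
  have hs : Real.sqrt 3 ^ 2 = 3 := Real.sq_sqrt (by norm_num)
  have hs0 : Real.sqrt 3 ≠ 0 := by positivity
  have hi : (Real.sqrt 3)⁻¹ = Real.sqrt 3 / 3 := by field_simp; linarith
  have hic : ((Real.sqrt 3 : ℂ))⁻¹ = ((Real.sqrt 3 / 3 : ℝ) : ℂ) := by rw [← hi]; push_cast; rfl
  have hn := normSq_first_column U
  have hN : (U.1 0 0).re ^ 2 + (U.1 0 0).im ^ 2 = (1 + blochZ U) / 2 := by
    simp only [blochZ]; linarith
  have hM : (U.1 1 0).re ^ 2 + (U.1 1 0).im ^ 2 = (1 - blochZ U) / 2 := by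
    simp only [blochZ]; linarith
  rw [Mlin0, smul_zeroS_add_smul_oneS, sum_expectation_pow _ ?_
    ((1 + blochZ U / 2 - Real.sqrt 3 / 2 * blochX U) / 6)
    ((1 + blochZ U / 2 + Real.sqrt 3 / 2 * blochX U) / 6)
    ((1 - blochZ U) / 6) (-(Real.sqrt 3 / 12 * blochY U))]
  · have hs4 : Real.sqrt 3 ^ 4 = 9 := by
      rw [show Real.sqrt 3 ^ 4 = (Real.sqrt 3 ^ 2) ^ 2 by ring, hs]; norm_num
    ring_nf
    simp only [hs, hs4]
    ring
  · simp only [cons_val_zero, div_eq_mul_inv, mul_inv, hic]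
    simp [Complex.normSq_apply]
    simp only [blochX]
    linear_combination (1 / 4 : ℝ) * hN + (1 / 12 : ℝ) * hM +
      ((U.1 1 0).re ^ 2 + (U.1 1 0).im ^ 2) / 36 * hs
  · simp only [cons_val_one, div_eq_mul_inv, mul_inv, hic]
    simp [Complex.normSq_apply]
    simp only [blochX]
    linear_combination (1 / 4 : ℝ) * hN + (1 / 12 : ℝ) * hM +
      ((U.1 1 0).re ^ 2 + (U.1 1 0).im ^ 2) / 36 * hs
  · simp only [cons_val, div_eq_mul_inv, hic]
    simp [Complex.normSq_apply]
    linear_combination (1 / 3 : ℝ) * hM + ((U.1 1 0).re ^ 2 + (U.1 1 0).im ^ 2) / 9 * hs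
  · simp only [cons_val_zero, cons_val_one, div_eq_mul_inv, mul_inv, hic]
    simp
    simp only [blochY]
    ring
  · simp only [cons_val_zero, cons_val_one, cons_val]
    field_simp
    ring

/-- The phase gate `diag(1, i)`. -/
def phaseGate : Matrix.unitaryGroup (Fin 2) ℂ :=
  ⟨!![1, 0; 0, Complex.I], by
    rw [Matrix.mem_unitaryGroup_iff]
    ext i j
    fin_cases i <;> fin_cases j <;> simp [Matrix.mul_apply, Fin.sum_univ_two]⟩

/-- The Pauli `X` gate. -/
def flipGate : Matrix.unitaryGroup (Fin 2) ℂ :=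
  ⟨!![0, 1; 1, 0], by
    rw [Matrix.mem_unitaryGroup_iff]
    ext i j
    fin_cases i <;> fin_cases j <;> simp [Matrix.mul_apply, Fin.sum_univ_two]⟩

/-- The Hadamard gate, up to a global phase. -/
def hadamardGate : Matrix.unitaryGroup (Fin 2) ℂ :=
  ⟨!![⟨1 / 2, 1 / 2⟩, ⟨1 / 2, 1 / 2⟩; ⟨1 / 2, 1 / 2⟩, ⟨-1 / 2, -1 / 2⟩], by
    rw [Matrix.mem_unitaryGroup_iff]
    ext i j
    fin_cases i <;> fin_cases j <;>
      simp [Matrix.mul_apply, Fin.sum_univ_two, Complex.ext_iff] <;> norm_num⟩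

/-- The diagonal unitary `diag(1, (3 + 4i) / 5)`. -/
def pythagoreanGate : Matrix.unitaryGroup (Fin 2) ℂ :=
  ⟨!![1, 0; 0, ⟨3 / 5, 4 / 5⟩], by
    rw [Matrix.mem_unitaryGroup_iff]
    ext i j
    fin_cases i <;> fin_cases j <;>
      simp [Matrix.mul_apply, Fin.sum_univ_two, Complex.ext_iff]
    norm_num⟩

lemma bloch_phaseGate_mul (U : Matrix.unitaryGroup (Fin 2) ℂ) :
    blochX (phaseGate * U) = -blochY U ∧ blochY (phaseGate * U) = blochX U ∧
      blochZ (phaseGate * U) = blochZ U := by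
  refine ⟨?_, ?_, ?_⟩ <;>
    simp [blochX, blochY, blochZ, phaseGate, Matrix.mul_apply, Fin.sum_univ_two] <;> ring

lemma bloch_flipGate_mul (U : Matrix.unitaryGroup (Fin 2) ℂ) :
    blochX (flipGate * U) = blochX U ∧ blochY (flipGate * U) = -blochY U ∧
      blochZ (flipGate * U) = -blochZ U := by
  refine ⟨?_, ?_, ?_⟩ <;>
    simp [blochX, blochY, blochZ, flipGate, Matrix.mul_apply, Fin.sum_univ_two] <;> ring

lemma bloch_hadamardGate_mul (U : Matrix.unitaryGroup (Fin 2) ℂ) :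
    blochX (hadamardGate * U) = blochZ U ∧ blochY (hadamardGate * U) = -blochY U ∧
      blochZ (hadamardGate * U) = blochX U := by
  refine ⟨?_, ?_, ?_⟩ <;>
    simp [blochX, blochY, blochZ, hadamardGate, Matrix.mul_apply, Fin.sum_univ_two] <;> ring

lemma bloch_pythagoreanGate_mul (U : Matrix.unitaryGroup (Fin 2) ℂ) :
    blochY (pythagoreanGate * U) = (4 * blochX U + 3 * blochY U) / 5 := by
  simp [blochX, blochY, pythagoreanGate, Matrix.mul_apply, Fin.sum_univ_two]
  ring

lemma continuous_unitary_re (i j : Fin 2) :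
    Continuous fun U : Matrix.unitaryGroup (Fin 2) ℂ => (U.1 i j).re :=
  Complex.continuous_re.comp (continuous_subtype_val.matrix_elem i j)

lemma continuous_unitary_im (i j : Fin 2) :
    Continuous fun U : Matrix.unitaryGroup (Fin 2) ℂ => (U.1 i j).im :=
  Complex.continuous_im.comp (continuous_subtype_val.matrix_elem i j)

lemma continuous_blochX : Continuous blochX :=
  (((continuous_unitary_re 0 0).mul (continuous_unitary_re 1 0)).add
    ((continuous_unitary_im 0 0).mul (continuous_unitary_im 1 0))).const_mul 2

lemma continuous_blochY : Continuous blochY :=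
  (((continuous_unitary_re 0 0).mul (continuous_unitary_im 1 0)).sub
    ((continuous_unitary_im 0 0).mul (continuous_unitary_re 1 0))).const_mul 2

lemma continuous_blochZ : Continuous blochZ :=
  (((continuous_unitary_re 0 0).pow 2).add ((continuous_unitary_im 0 0).pow 2)).sub
    (((continuous_unitary_re 1 0).pow 2).add ((continuous_unitary_im 1 0).pow 2))

section Moments

variable (μ : Measure (Matrix.unitaryGroup (Fin 2) ℂ))

lemma integrable_bloch_monomial [IsFiniteMeasure μ] (i j k : ℕ) :
    Integrable (fun U => blochX U ^ i * blochY U ^ j * blochZ U ^ k) μ := by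
  have hx := continuous_blochX
  have hy := continuous_blochY
  have hz := continuous_blochZ
  refine Integrable.of_bound (C := 1) (Continuous.aestronglyMeasurable (by fun_prop))
    (Filter.Eventually.of_forall fun U => ?_)
  have h := bloch_sq_add U
  have h1 : |blochX U| ≤ 1 := by
    rw [← sq_le_one_iff_abs_le_one]
    nlinarith [sq_nonneg (blochY U), sq_nonneg (blochZ U)]
  have h2 : |blochY U| ≤ 1 := by
    rw [← sq_le_one_iff_abs_le_one]
    nlinarith [sq_nonneg (blochX U), sq_nonneg (blochZ U)]
  have h3 : |blochZ U| ≤ 1 := by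
    rw [← sq_le_one_iff_abs_le_one]
    nlinarith [sq_nonneg (blochY U), sq_nonneg (blochX U)]
  rw [Real.norm_eq_abs, abs_mul, abs_mul, abs_pow, abs_pow, abs_pow]
  exact mul_le_one₀ (mul_le_one₀ (pow_le_one₀ (abs_nonneg _) h1) (by positivity)
    (pow_le_one₀ (abs_nonneg _) h2)) (by positivity) (pow_le_one₀ (abs_nonneg _) h3)

/-- The moments of the Bloch vector. -/
def blochMoment (i j k : ℕ) : ℝ := ∫ U, blochX U ^ i * blochY U ^ j * blochZ U ^ k ∂μ

lemma integral_sum_bloch_monomial [IsFiniteMeasure μ] {n : ℕ} (c : Fin n → ℝ)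
    (e : Fin n → ℕ × ℕ × ℕ) :
    ∫ U, ∑ m, c m * (blochX U ^ (e m).1 * blochY U ^ (e m).2.1 * blochZ U ^ (e m).2.2) ∂μ =
      ∑ m, c m * blochMoment μ (e m).1 (e m).2.1 (e m).2.2 := by
  rw [integral_finsetSum _ fun m _ => (integrable_bloch_monomial μ _ _ _).const_mul _]
  simp only [integral_const_mul, blochMoment]

variable [μ.IsHaarMeasure]

lemma blochMoment_phase (i j k : ℕ) : blochMoment μ i j k = (-1) ^ i * blochMoment μ j i k := by
  rw [blochMoment, ← integral_mul_left_eq_self _ phaseGate, blochMoment, ← integral_const_mul]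
  congr 1
  ext U
  obtain ⟨h1, h2, h3⟩ := bloch_phaseGate_mul U
  rw [h1, h2, h3, neg_pow]
  ring

lemma blochMoment_flip (i j k : ℕ) :
    blochMoment μ i j k = (-1) ^ j * (-1) ^ k * blochMoment μ i j k := by
  nth_rw 1 [blochMoment]
  rw [← integral_mul_left_eq_self _ flipGate, blochMoment, ← integral_const_mul]
  congr 1
  ext U
  obtain ⟨h1, h2, h3⟩ := bloch_flipGate_mul U
  rw [h1, h2, h3, neg_pow, neg_pow (blochZ U)]
  ring

lemma blochMoment_hadamard (i j k : ℕ) : blochMoment μ i j k = (-1) ^ j * blochMoment μ k j i := by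
  rw [blochMoment, ← integral_mul_left_eq_self _ hadamardGate, blochMoment, ← integral_const_mul]
  congr 1
  ext U
  obtain ⟨h1, h2, h3⟩ := bloch_hadamardGate_mul U
  rw [h1, h2, h3, neg_pow]
  ring

lemma blochMoment_sq [IsProbabilityMeasure μ] :
    blochMoment μ 2 0 0 = 1 / 3 ∧ blochMoment μ 0 2 0 = 1 / 3 ∧ blochMoment μ 0 0 2 = 1 / 3 := by
  have hxy := blochMoment_phase μ 2 0 0
  have hxz := blochMoment_hadamard μ 2 0 0
  have hsum := integral_sum_bloch_monomial μ ![1, 1, 1] ![(2, 0, 0), (0, 2, 0), (0, 0, 2)]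
  simp only [Fin.sum_univ_succ, Fin.sum_univ_zero] at hsum
  simp [← add_assoc, bloch_sq_add] at hsum
  norm_num at hxy hxz
  exact ⟨by linarith, by linarith, by linarith⟩

lemma blochMoment_pow_four [IsProbabilityMeasure μ] :
    blochMoment μ 4 0 0 = 1 / 5 ∧ blochMoment μ 0 4 0 = 1 / 5 ∧ blochMoment μ 0 0 4 = 1 / 5 ∧
      blochMoment μ 2 0 2 = 1 / 15 := by
  have hxy := blochMoment_phase μ 4 0 0
  have hxz := blochMoment_hadamard μ 4 0 0
  have hxy_yz := blochMoment_hadamard μ 2 2 0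
  have hxz_yz := blochMoment_phase μ 2 0 2
  have hodd := blochMoment_flip μ 3 1 0
  have hodd' := blochMoment_flip μ 1 3 0
  have hsum := (integral_sum_bloch_monomial μ ![1, 1, 1, 2, 2, 2]
    ![(4, 0, 0), (0, 4, 0), (0, 0, 4), (2, 2, 0), (2, 0, 2), (0, 2, 2)]).symm.trans
    (c := 1) <| (integral_congr_ae (g := fun _ => 1) (.of_forall fun U => by
      have h := bloch_sq_add U
      simp only [Fin.sum_univ_succ, Fin.sum_univ_zero]
      simp
      linear_combination (blochX U ^ 2 + blochY U ^ 2 + blochZ U ^ 2 + 1) * h)).trans (by simp)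
  have hrot := (integral_sum_bloch_monomial μ
    ![256 / 625, 768 / 625, 864 / 625, 432 / 625, 81 / 625]
    ![(4, 0, 0), (3, 1, 0), (2, 2, 0), (1, 3, 0), (0, 4, 0)]).symm.trans
    (c := blochMoment μ 0 4 0) <| by
      rw [blochMoment, ← integral_mul_left_eq_self (fun U => blochX U ^ 0 * _ * _) pythagoreanGate]
      congr 1
      ext U
      rw [bloch_pythagoreanGate_mul]
      simp only [Fin.sum_univ_succ, Fin.sum_univ_zero]
      simp
      ring
  simp only [Fin.sum_univ_succ, Fin.sum_univ_zero] at hsum hrot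
  simp at hsum hrot
  norm_num at hxy hxz hxy_yz hxz_yz hodd hodd'
  exact ⟨by linarith, by linarith, by linarith, by linarith⟩

end Moments


/-- the average linear stabilizer entropy of a Haar-random state
`u₀₀|0_s⟩ + u₁₀|1_s⟩` of the intertwiner subspace of four qubits, computed with respect
to the full 4-qubit Pauli basis, equals 17/45. Here `(u₀₀, u₁₀)` is the first column of
the Haar-random `U ∈ U(2)`. -/
theorem average_linear_SE_intertwiner_ambient
    (μ : Measure (Matrix.unitaryGroup (Fin 2) ℂ)) [μ.IsHaarMeasure]
    [IsProbabilityMeasure μ] :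
    (∫ U : Matrix.unitaryGroup (Fin 2) ℂ,
        Mlin0 (((U : Matrix (Fin 2) (Fin 2) ℂ) 0 0) • zeroS +
               ((U : Matrix (Fin 2) (Fin 2) ℂ) 1 0) • oneS) ∂μ) = 17 / 45 := by
  obtain ⟨hx, -, hz⟩ := blochMoment_sq μ
  obtain ⟨hx4, hy4, hz4, hxz⟩ := blochMoment_pow_four μ
  have hzzz := blochMoment_flip μ 0 0 3
  have hxxz := blochMoment_flip μ 2 0 1
  have hint := integral_sum_bloch_monomial μ
    ![13 / 18, -1 / 6, -1 / 3, -1 / 3, -1 / 6, -1 / 3, -1 / 6, -2 / 9, 2 / 3]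
    ![(0, 0, 0), (0, 4, 0), (2, 0, 0), (0, 0, 2), (4, 0, 0), (2, 0, 2), (0, 0, 4), (0, 0, 3),
      (2, 0, 1)]
  have h0 : blochMoment μ 0 0 0 = 1 := by simp [blochMoment]
  refine (integral_congr_ae (Filter.Eventually.of_forall fun U => ?_)).trans (hint.trans ?_)
  · refine (Mlin0_eq_bloch U).trans ?_
    simp only [Fin.sum_univ_succ, Fin.sum_univ_zero]
    simp
    ring
  · simp only [Fin.sum_univ_succ, Fin.sum_univ_zero]
    norm_num at hzzz hxxz
    simp
    linarith
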